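/- arXiv:2210.10564 — 5 statements merged into one kernel-verified Lean document; each statement's English description precedes it below -/
import Mathlib

section
/- For every g ∈ GL_n(k) there exists a permutation w' ∈ S_n such that 𝔟_g = Σ_{c ∈ 𝔠_n} (𝔟_g ∩ 𝔟_{c·w'})^{gr=w0}; that is, the k-subspace 𝔟_g is the sum, over all full cycles c ∈ 𝔠_n, of the subspaces (𝔟_g ∩ 𝔟_{P_c·P_{w'}})^{gr=w0} of M_n(k). -/
/-- The permutation matrix `P_w ∈ GL_n(k)` determined by `P_w e_b = e_{w b}`. -/
def permMat (k : Type*) [Field k] {n : ℕ} (w : Equiv.Perm (Fin n)) :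
    Matrix (Fin n) (Fin n) k :=
  Matrix.of fun a b => if a = w b then 1 else 0

/-- `𝔟_g = g⁻¹ 𝔟 g`: the set of matrices `M` such that `g * M * g⁻¹` is upper
triangular (here `g'` stands for the inverse of `g`). -/
def borelConj {n : ℕ} {k : Type*} [Field k] (g g' : Matrix (Fin n) (Fin n) k) :
    Set (Matrix (Fin n) (Fin n) k) :=
  {M | ∀ a b : Fin n, b < a → (g * M * g') a b = 0}

/-- `(𝔟_g ∩ 𝔟_h)^{gr = w0}`: the matrices `M` in `𝔟_g ∩ 𝔟_h` such that
`(h M h⁻¹)_{ii} = (g M g⁻¹)_{w0(i), w0(i)}` for all `i`, where `w0 : i ↦ n+1-i`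
(`Fin.rev` in 0-indexed terms).  `g'` and `h'` stand for the inverses of `g`, `h`. -/
def grSet {n : ℕ} {k : Type*} [Field k] (g g' h h' : Matrix (Fin n) (Fin n) k) :
    Set (Matrix (Fin n) (Fin n) k) :=
  {M | M ∈ borelConj g g' ∧ M ∈ borelConj h h' ∧
    ∀ i : Fin n, (h * M * h') i i = (g * M * g') i.rev i.rev}

/-- `c` is the full cycle `c_{i,j} = (i, i-1, …, j+1, j)` (for `j ≤ i`): it sends
`j` to `i`, sends `a` to `a - 1` for `j < a ≤ i`, and fixes all other points. -/
def IsFullCycleAt {n : ℕ} (c : Equiv.Perm (Fin n)) (i j : Fin n) : Prop :=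
  c j = i ∧ (∀ a : Fin n, j < a → a ≤ i → (c a : ℕ) = (a : ℕ) - 1) ∧
    ∀ a : Fin n, ¬(j ≤ a ∧ a ≤ i) → c a = a

/-- `c ∈ 𝔠_n`, the set of full cycles `c_{i,j}` for `1 ≤ j ≤ i ≤ n`. -/
def IsFullCycle {n : ℕ} (c : Equiv.Perm (Fin n)) : Prop :=
  ∃ i j : Fin n, j ≤ i ∧ IsFullCycleAt c i j

/-- Gaussian elimination: `x` can be cleared at the pivots `p 0, …, p (m - 1)` of an echelon
family `f`, staying in its class modulo a submodule that contains the family. -/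
theorem exists_sub_mem_eq_zero {ι k : Type*} [Field k] (K : Submodule k (ι → k))
    (p : ℕ → ι) (f : ℕ → ι → k) (x : ι → k) (m : ℕ)
    (hK : ∀ b < m, f b ∈ K) (hne : ∀ b < m, f b (p b) ≠ 0)
    (hz : ∀ a < m, ∀ b < a, f a (p b) = 0) :
    ∃ y, y - x ∈ K ∧ ∀ b < m, y (p b) = 0 := by
  induction m with
  | zero => exact ⟨x, by simp, by simp⟩
  | succ m ih =>
    obtain ⟨y, hy, hy0⟩ := ih (fun b hb => hK b (by omega)) (fun b hb => hne b (by omega))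
      (fun a ha => hz a (by omega))
    refine ⟨y - (y (p m) / f m (p m)) • f m, ?_, fun b hb => ?_⟩
    · rw [sub_right_comm]
      exact K.sub_mem hy (K.smul_mem _ (hK m (by omega)))
    · rcases Nat.lt_succ_iff_lt_or_eq.mp hb with h | rfl
      · simp [hy0 b h, hz m (by omega) b h]
      · simp [div_mul_cancel₀ _ (hne b hb)]

/-- An invertible `g` admits an echelon family `f b ∈ g⁻¹⟨e_0, …, e_b⟩` with pivots `p b`. -/
theorem exists_echelon {n : ℕ} {k : Type*} [Field k] (g g' : Matrix (Fin n) (Fin n) k)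
    (hgg' : g * g' = 1) (m : ℕ) (hm : m ≤ n) (p₀ : Fin n) :
    ∃ (p : ℕ → Fin n) (f : ℕ → Fin n → k), ∀ a < m,
      (∀ i : Fin n, a < (i : ℕ) → g.mulVec (f a) i = 0) ∧ f a (p a) ≠ 0 ∧
        ∀ b < a, f a (p b) = 0 := by
  induction m with
  | zero => exact ⟨fun _ => p₀, 0, by simp⟩
  | succ m ih =>
    obtain ⟨p, f, h⟩ := ih (by omega)
    let K : Submodule k (Fin n → k) :=
      { carrier := {v | ∀ i : Fin n, m ≤ (i : ℕ) → g.mulVec v i = 0}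
        add_mem' := fun {u v} hu hv i hi => by
          simp [Matrix.mulVec_add, hu i hi, hv i hi]
        zero_mem' := by simp
        smul_mem' := fun c v hv i hi => by simp [Matrix.mulVec_smul, hv i hi] }
    obtain ⟨y, hy, hy0⟩ := exists_sub_mem_eq_zero K p f
      (g'.mulVec (Pi.single ⟨m, hm⟩ 1)) m
      (fun b hb i hi => (h b hb).1 i (by omega)) (fun b hb => (h b hb).2.1)
      (fun a ha => (h a ha).2.2)
    have hgy : ∀ i : Fin n, m ≤ (i : ℕ) →
        g.mulVec y i = (Pi.single ⟨m, hm⟩ 1 : Fin n → k) i := fun i hi => by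
      have := hy i hi
      rwa [Matrix.mulVec_sub, Matrix.mulVec_mulVec, hgg', Matrix.one_mulVec, Pi.sub_apply,
        sub_eq_zero] at this
    have hyne : y ≠ 0 := by
      rintro rfl
      simpa using hgy ⟨m, hm⟩ le_rfl
    obtain ⟨q, hq⟩ := Function.ne_iff.mp hyne
    refine ⟨Function.update p m q, Function.update f m y, fun a ha => ?_⟩
    rcases Nat.lt_succ_iff_lt_or_eq.mp ha with ha | rfl
    · obtain ⟨h1, h2, h3⟩ := h a ha
      refine ⟨?_, ?_, fun b hb => ?_⟩
      · simpa [Function.update_of_ne ha.ne] using h1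
      · simpa [Function.update_of_ne ha.ne] using h2
      · simpa [Function.update_of_ne ha.ne, Function.update_of_ne (hb.trans ha).ne] using h3 b hb
    · refine ⟨fun i hi => ?_, by simpa using hq, fun b hb => ?_⟩
      · rw [Function.update_self, hgy i hi.le, Pi.single_eq_of_ne]
        rintro rfl
        exact lt_irrefl _ hi
      · simpa [Function.update_of_ne hb.ne] using hy0 b hb

theorem exists_echelon_matrix {n : ℕ} [NeZero n] {k : Type*} [Field k]
    (g g' : Matrix (Fin n) (Fin n) k) (hgg' : g * g' = 1) :
    ∃ (π : Equiv.Perm (Fin n)) (Φ : Matrix (Fin n) (Fin n) k),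
      (g * Φ).BlockTriangular id ∧ (Φ.submatrix π id).BlockTriangular OrderDual.toDual ∧
        ∀ a, Φ (π a) a ≠ 0 := by
  obtain ⟨p, f, h⟩ := exists_echelon g g' hgg' n le_rfl 0
  have hinj : Function.Injective fun a : Fin n => p a := by
    intro a b (hab : p a = p b)
    by_contra hne
    rcases lt_or_gt_of_ne hne with hlt | hlt
    · exact (h b b.2).2.1 (by rw [← hab]; exact (h b b.2).2.2 a hlt)
    · exact (h a a.2).2.1 (by rw [hab]; exact (h a a.2).2.2 b hlt)
  refine ⟨Equiv.ofBijective _ (Finite.injective_iff_bijective.mp hinj),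
    Matrix.of fun x b => f b x, fun a b hab => ?_, fun a b hab => ?_, fun a => ?_⟩
  · exact (h b b.2).1 a hab
  · exact (h b b.2).2.2 a hab
  · exact (h a a.2).2.1

theorem Matrix.BlockTriangular.mul_apply_self {n : ℕ} {k : Type*} [Field k]
    {A B : Matrix (Fin n) (Fin n) k} (hA : A.BlockTriangular id) (hB : B.BlockTriangular id)
    (a : Fin n) : (A * B) a a = A a a * B a a := by
  rw [Matrix.mul_apply, Finset.sum_eq_single a]
  · intro b _ hb
    rcases lt_or_gt_of_ne hb with h | h
    · rw [hA h, zero_mul]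
    · rw [hB h, mul_zero]
  · simp

theorem permMat_mul_mul_apply {n : ℕ} {k : Type*} [Field k] (σ : Equiv.Perm (Fin n))
    (M : Matrix (Fin n) (Fin n) k) (a b : Fin n) :
    (permMat k σ * M * permMat k σ⁻¹) a b = M (σ⁻¹ a) (σ⁻¹ b) := by
  have h : ∀ x, a = σ x ↔ σ⁻¹ a = x := fun x => by rw [Equiv.Perm.inv_eq_iff_eq]
  simp [Matrix.mul_apply, permMat, h]

section grSet

variable {n : ℕ} {k : Type*} [Field k] {g g' h h' : Matrix (Fin n) (Fin n) k}

theorem zero_mem_grSet : (0 : Matrix (Fin n) (Fin n) k) ∈ grSet g g' h h' := by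
  simp [grSet, borelConj]

theorem add_mem_grSet {M N : Matrix (Fin n) (Fin n) k} (hM : M ∈ grSet g g' h h')
    (hN : N ∈ grSet g g' h h') : M + N ∈ grSet g g' h h' := by
  refine ⟨fun a b hab => ?_, fun a b hab => ?_, fun i => ?_⟩
  · simp [Matrix.mul_add, Matrix.add_mul, hM.1 a b hab, hN.1 a b hab]
  · simp [Matrix.mul_add, Matrix.add_mul, hM.2.1 a b hab, hN.2.1 a b hab]
  · simp [Matrix.mul_add, Matrix.add_mul, hM.2.2 i, hN.2.2 i]

theorem smul_mem_grSet (x : k) {M : Matrix (Fin n) (Fin n) k} (hM : M ∈ grSet g g' h h') :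
    x • M ∈ grSet g g' h h' := by
  refine ⟨fun a b hab => ?_, fun a b hab => ?_, fun i => ?_⟩
  · simp [hM.1 a b hab]
  · simp [hM.2.1 a b hab]
  · simp [hM.2.2 i]

end grSet

theorem IsFullCycleAt.apply_le_iff {n : ℕ} {c : Equiv.Perm (Fin n)} {i j : Fin n}
    (hc : IsFullCycleAt c i j) (a : Fin n) : c a ≤ i ↔ a ≤ i := by
  obtain ⟨h1, h2, h3⟩ := hc
  by_cases ha : j ≤ a ∧ a ≤ i
  · rcases ha.1.eq_or_lt with rfl | hlt
    · simp [h1, ha.2]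
    · have := h2 a hlt ha.2
      simp only [ha.2, iff_true, Fin.le_def]
      have := Fin.le_def.mp ha.2
      omega
  · rw [h3 a ha]

theorem isFullCycleAt_cycleIcc_inv {n : ℕ} [NeZero n] {i j : Fin n} (hij : j ≤ i) :
    IsFullCycleAt (Fin.cycleIcc j i)⁻¹ i j := by
  refine ⟨?_, fun a hja hai => ?_, fun a ha => ?_⟩
  · rw [Equiv.Perm.inv_eq_iff_eq, Fin.cycleIcc_of_last hij]
  · rw [Fin.lt_def] at hja
    rw [Fin.le_def] at hai
    have h : (Fin.cycleIcc j i)⁻¹ a = ⟨a - 1, by omega⟩ := by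
      rw [Equiv.Perm.inv_eq_iff_eq, Fin.cycleIcc_of_ge_of_lt (Fin.le_def.mpr (by simp; omega))
        (Fin.lt_def.mpr (by simp; omega))]
      ext
      rw [Fin.val_add_one_of_lt']
      · simp
        omega
      · simp
        omega
    rw [h]
  · rw [Equiv.Perm.inv_eq_iff_eq]
    rcases lt_or_ge a j with h | h
    · rw [Fin.cycleIcc_of_lt h]
    · rw [Fin.cycleIcc_of_gt (not_le.mp fun h' => ha ⟨h, h'⟩)]

/-- The elementary matrices whose conjugates span `𝔟_g`: row `i` is the row `j` of `U`, truncated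
to the columns `≥ i`. -/
def truncRow {n : ℕ} {k : Type*} [Field k] (U : Matrix (Fin n) (Fin n) k) (i j : Fin n) :
    Matrix (Fin n) (Fin n) k :=
  Matrix.of fun p q => if p = i ∧ i ≤ q then U j q else 0

section truncRow

variable {n : ℕ} {k : Type*} [Field k] {U V : Matrix (Fin n) (Fin n) k}

theorem truncRow_blockTriangular (U : Matrix (Fin n) (Fin n) k) (i j : Fin n) :
    (truncRow U i j).BlockTriangular id := by
  intro a b hab
  simp only [truncRow, Matrix.of_apply]
  rw [if_neg]
  rintro ⟨rfl, h⟩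
  exact absurd hab (not_lt.mpr h)

theorem sum_smul_truncRow (hU : U.BlockTriangular OrderDual.toDual) (hVU : V * U = 1)
    {N : Matrix (Fin n) (Fin n) k} (hN : N.BlockTriangular id) :
    ∑ i, ∑ j, (if i ≤ j then (N * V) i j • truncRow U i j else 0) = N := by
  ext p q
  have hNVU : N * V * U = N := by rw [Matrix.mul_assoc, hVU, Matrix.mul_one]
  simp only [Matrix.sum_apply]
  rw [Finset.sum_eq_single p]
  · rcases lt_or_ge q p with hqp | hpq
    · rw [hN hqp]
      refine Finset.sum_eq_zero fun j _ => ?_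
      split_ifs
      · simp [truncRow, not_le.mpr hqp]
      · rfl
    · conv_rhs => rw [← hNVU, Matrix.mul_apply]
      refine Finset.sum_congr rfl fun j _ => ?_
      split_ifs with hj
      · simp [truncRow, hpq]
      · rw [hU (show OrderDual.toDual q < OrderDual.toDual j from
          (not_le.mp hj).trans_le hpq)]
        simp
  · intro i _ hi
    refine Finset.sum_eq_zero fun j _ => ?_
    split_ifs
    · simp [truncRow, hi.symm]
    · rfl
  · simp

theorem mul_truncRow_mul_apply (hV : V.BlockTriangular OrderDual.toDual) (hUV : U * V = 1)
    (i j x : Fin n) {y : Fin n} (hy : i ≤ y) :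
    (U * truncRow U i j * V) x y = if j = y then U x i else 0 := by
  have h1 : ∀ q, (U * truncRow U i j) x q = if i ≤ q then U x i * U j q else 0 := by
    intro q
    simp [Matrix.mul_apply, truncRow, ite_and]
  have h2 : (U * truncRow U i j * V) x y = U x i * (U * V) j y := by
    rw [Matrix.mul_apply, Matrix.mul_apply, Finset.mul_sum]
    refine Finset.sum_congr rfl fun q _ => ?_
    rw [h1]
    split_ifs with hq
    · ring
    · rw [hV (show OrderDual.toDual y < OrderDual.toDual q from (not_le.mp hq).trans_le hy)]
      simp
  rw [h2, hUV, Matrix.one_apply]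
  simp

theorem mul_truncRow_mul_apply_of_lt (hU : U.BlockTriangular OrderDual.toDual)
    (i j y : Fin n) {x : Fin n} (hx : x < i) : (U * truncRow U i j * V) x y = 0 := by
  have h1 : ∀ q, (U * truncRow U i j) x q = 0 := by
    intro q
    simp [Matrix.mul_apply, truncRow, ite_and,
      hU (show OrderDual.toDual i < OrderDual.toDual x from hx)]
  simp [Matrix.mul_apply (M := U * truncRow U i j), h1]

end truncRow

theorem conj_truncRow_mem_grSet {n : ℕ} {k : Type*} [Field k]
    {g g' Φ Ψ : Matrix (Fin n) (Fin n) k} {π : Equiv.Perm (Fin n)}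
    (hβ : (g * Φ).BlockTriangular id) (hγ : (Ψ * g').BlockTriangular id)
    (hβγ : g * Φ * (Ψ * g') = 1) (hΦΨ : Φ * Ψ = 1)
    (hU : (Φ.submatrix π id).BlockTriangular OrderDual.toDual)
    (hV : (Ψ.submatrix id π).BlockTriangular OrderDual.toDual)
    {c : Equiv.Perm (Fin n)} {i j : Fin n} (hc : IsFullCycleAt c i.rev j.rev) :
    Φ * truncRow (Φ.submatrix π id) i j * Ψ ∈
      grSet g g' (permMat k (c * (π⁻¹.trans Fin.revPerm)))
        (permMat k (c * (π⁻¹.trans Fin.revPerm))⁻¹) := by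
  set U := Φ.submatrix π id with hUdef
  set V := Ψ.submatrix id π with hVdef
  set N := truncRow U i j with hNdef
  have hN : N.BlockTriangular id := truncRow_blockTriangular U i j
  have hUV : U * V = 1 := by
    rw [hUdef, hVdef, ← Matrix.submatrix_mul _ _ _ _ _ Function.bijective_id, hΦΨ]
    simp
  have hg : g * (Φ * N * Ψ) * g' = g * Φ * N * (Ψ * g') := by simp only [Matrix.mul_assoc]
  have hdiag : ∀ a, (g * (Φ * N * Ψ) * g') a a = N a a := fun a => by
    have h := congrFun (congrFun hβγ a) a
    rw [hβ.mul_apply_self hγ, Matrix.one_apply_eq] at h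
    rw [hg, (hβ.mul hN).mul_apply_self hγ, hβ.mul_apply_self hN, mul_right_comm, h, one_mul]
  have hsub : ∀ x y, (Φ * N * Ψ) (π x) (π y) = (U * N * V) x y := fun x y => rfl
  have hperm : ∀ a b, (permMat k (c * (π⁻¹.trans Fin.revPerm)) * (Φ * N * Ψ) *
      permMat k (c * (π⁻¹.trans Fin.revPerm))⁻¹) a b =
        (U * N * V) (c⁻¹ a).rev (c⁻¹ b).rev := fun a b => by
    rw [permMat_mul_mul_apply, ← hsub]
    rfl
  have hle : ∀ a, i ≤ (c⁻¹ a).rev ↔ a ≤ i.rev := fun a => by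
    rw [← Fin.rev_le_rev, Fin.rev_rev, ← hc.apply_le_iff]
    simp
  have heq : ∀ a, j = (c⁻¹ a).rev ↔ a = i.rev := fun a => by
    rw [← Fin.rev_inj, Fin.rev_rev, eq_comm, Equiv.Perm.inv_eq_iff_eq, hc.1]
  refine ⟨fun a b hab => ?_, fun a b hab => ?_, fun a => ?_⟩
  · rw [hg]
    exact ((hβ.mul hN).mul hγ) hab
  · rw [hperm]
    by_cases ha : a ≤ i.rev
    · rw [mul_truncRow_mul_apply hV hUV i j _ ((hle b).mpr (hab.le.trans ha)), if_neg]
      rw [heq]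
      exact (hab.trans_le ha).ne
    · exact mul_truncRow_mul_apply_of_lt hU i j _ (not_le.mp (mt (hle a).mp ha))
  · rw [hperm, hdiag]
    by_cases ha : a ≤ i.rev
    · rw [mul_truncRow_mul_apply hV hUV i j _ ((hle a).mpr ha)]
      by_cases hai : a = i.rev
      · rw [if_pos ((heq a).mpr hai), ← (heq a).mpr hai]
        simp [hNdef, truncRow, hai]
      · rw [if_neg (mt (heq a).mp hai)]
        have : a.rev ≠ i := fun h => hai (by rw [← h, Fin.rev_rev])
        simp [hNdef, truncRow, this]
    · rw [mul_truncRow_mul_apply_of_lt hU i j _ (not_le.mp (mt (hle a).mp ha))]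
      have : a.rev ≠ i := fun h => ha (by rw [← h, Fin.rev_rev])
      simp [hNdef, truncRow, this]

/-- For every `g ∈ GL_n(k)` there is `w' ∈ S_n` with
`𝔟_g = Σ_{c ∈ 𝔠_n} (𝔟_g ∩ 𝔟_{c·w'})^{gr = w0}`; the sum of subspaces is expressed
by decomposing each element of `𝔟_g` as a finite sum of elements of the
subspaces `(𝔟_g ∩ 𝔟_{P_c · P_{w'}})^{gr = w0}`, and conversely. -/
theorem statement0 {n : ℕ} [NeZero n] {k : Type*} [Field k]
    (g g' : Matrix (Fin n) (Fin n) k) (hgg' : g * g' = 1) (hg'g : g' * g = 1) :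
    ∃ w' : Equiv.Perm (Fin n),
      ∀ M : Matrix (Fin n) (Fin n) k,
        M ∈ borelConj g g' ↔
          ∃ f : Equiv.Perm (Fin n) → Matrix (Fin n) (Fin n) k,
            (∀ c : Equiv.Perm (Fin n), IsFullCycle c →
              f c ∈ grSet g g' (permMat k (c * w')) (permMat k ((c * w')⁻¹))) ∧
            (∀ c : Equiv.Perm (Fin n), ¬IsFullCycle c → f c = 0) ∧
            M = ∑ c : Equiv.Perm (Fin n), f c := by
  classical
  obtain ⟨π, Φ, hβ, hU, hdiag⟩ := exists_echelon_matrix g g' hgg'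
  have hUdet : IsUnit (Φ.submatrix π id).det := by
    rw [Matrix.det_of_isLowerTriangular _ hU, isUnit_iff_ne_zero]
    exact Finset.prod_ne_zero_iff.mpr fun a _ => hdiag a
  set V := (Φ.submatrix π id)⁻¹ with hVdef
  have hVtri : V.BlockTriangular OrderDual.toDual := by
    let := Matrix.invertibleOfIsUnitDet _ hUdet
    exact Matrix.blockTriangular_inv_of_blockTriangular hU
  obtain ⟨Ψ, hΨ⟩ : ∃ Ψ : Matrix (Fin n) (Fin n) k, Ψ.submatrix id π = V :=
    ⟨V.submatrix id π.symm, by ext; simp⟩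
  rw [← hΨ] at hVtri
  have hVU : Ψ.submatrix id π * Φ.submatrix π id = 1 := by
    rw [hΨ, hVdef, Matrix.nonsing_inv_mul _ hUdet]
  have hΨΦ : Ψ * Φ = 1 := by
    rw [← hVU, Matrix.submatrix_mul_equiv, Matrix.submatrix_id_id]
  have hΦΨ : Φ * Ψ = 1 := mul_eq_one_comm.mp hΨΦ
  have hβγ : g * Φ * (Ψ * g') = 1 := by
    rw [Matrix.mul_assoc, ← Matrix.mul_assoc Φ, hΦΨ, Matrix.one_mul, hgg']
  have hγ : (Ψ * g').BlockTriangular id := by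
    let := Matrix.invertibleOfIsUnitDet _ (Matrix.isUnit_det_of_right_inverse hβγ)
    rw [← Matrix.inv_eq_right_inv hβγ]
    exact Matrix.blockTriangular_inv_of_blockTriangular hβ
  refine ⟨π⁻¹.trans Fin.revPerm, fun M => ⟨fun hM => ?_, ?_⟩⟩
  · set U := Φ.submatrix π id with hUdef
    set N := Ψ * M * Φ with hNdef
    have hN : N.BlockTriangular id := by
      have h : N = Ψ * g' * (g * M * g') * (g * Φ) := by
        calc N = Ψ * (g' * g) * M * (g' * g) * Φ := by
              rw [hg'g, Matrix.mul_one, Matrix.mul_one]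
          _ = _ := by simp only [Matrix.mul_assoc]
      rw [h]
      exact (hγ.mul fun a b hab => hM a b hab).mul hβ
    have hMN : M = Φ * N * Ψ := by
      calc M = (Φ * Ψ) * M * (Φ * Ψ) := by rw [hΦΨ, Matrix.mul_one, Matrix.one_mul]
        _ = _ := by simp only [hNdef, Matrix.mul_assoc]
    let t : Fin n → Fin n → Matrix (Fin n) (Fin n) k := fun i j =>
      if i ≤ j then (N * Ψ.submatrix id π) i j • (Φ * truncRow U i j * Ψ) else 0
    refine ⟨fun c => ∑ i, ∑ j, if (Fin.cycleIcc j.rev i.rev)⁻¹ = c then t i j else 0,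
      fun c _ => ?_, fun c hc => ?_, ?_⟩
    · refine Finset.sum_induction _ (· ∈ grSet _ _ _ _) (fun _ _ => add_mem_grSet)
        zero_mem_grSet fun i _ => Finset.sum_induction _ (· ∈ grSet _ _ _ _)
          (fun _ _ => add_mem_grSet) zero_mem_grSet fun j _ => ?_
      by_cases hcij : (Fin.cycleIcc j.rev i.rev)⁻¹ = c
      · by_cases hij : i ≤ j
        · simp only [t, if_pos hcij, if_pos hij]
          exact smul_mem_grSet _ (conj_truncRow_mem_grSet hβ hγ hβγ hΦΨ hU hVtri
            (hcij ▸ isFullCycleAt_cycleIcc_inv (Fin.rev_le_rev.mpr hij)))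
        · simpa only [t, if_pos hcij, if_neg hij] using zero_mem_grSet
      · simpa only [if_neg hcij] using zero_mem_grSet
    · refine Finset.sum_eq_zero fun i _ => Finset.sum_eq_zero fun j _ => ?_
      by_cases hij : i ≤ j
      · rw [if_neg]
        rintro rfl
        exact hc ⟨_, _, Fin.rev_le_rev.mpr hij,
          isFullCycleAt_cycleIcc_inv (Fin.rev_le_rev.mpr hij)⟩
      · simp [t, hij]
    · calc M = Φ * (∑ i, ∑ j, if i ≤ j then (N * Ψ.submatrix id π) i j • truncRow U i j else 0)
              * Ψ := by rw [sum_smul_truncRow hU hVU hN, ← hMN]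
        _ = ∑ i, ∑ j, t i j := by
          simp only [Finset.mul_sum, Finset.sum_mul]
          refine Finset.sum_congr rfl fun i _ => Finset.sum_congr rfl fun j _ => ?_
          simp only [t]
          split_ifs <;> simp
        _ = _ := by
          rw [Finset.sum_comm]
          simp only [Finset.sum_comm (γ := Equiv.Perm (Fin n))]
          rw [Finset.sum_comm]
          simp
  · rintro ⟨f, hf, hf0, rfl⟩
    intro a b hab
    rw [Finset.mul_sum, Finset.sum_mul, Matrix.sum_apply]
    refine Finset.sum_eq_zero fun c _ => ?_
    by_cases hc : IsFullCycle c
    · exact (hf c hc).1 a b hab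
    · simp [hf0 c hc]
end

section
/- If a permutation w ∈ S_n is a product of k pairwise distinct adjacent transpositions, i.e. w = s_{i_1}·s_{i_2}·⋯·s_{i_k} where s_i denotes the transposition (i, i+1) and i_1,…,i_k are pairwise distinct elements of {1,…,n−1}, then w has exactly n − k orbits on {1,…,n}; equivalently, for any field k0, the fixed subspace {v ∈ k0^n : v_{w(a)} = v_a for all a} of the permutation action of w on k0^n has dimension n − k. -/
open Finset Module

/-- `i + 1` in `Fin n` has the expected value when it does not wrap around. -/
lemma Fin.val_add_one_of_lt_bound {n : ℕ} [NeZero n] {i : Fin n} (hi : (i : ℕ) + 1 < n) :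
    ((i + 1 : Fin n) : ℕ) = i + 1 := by
  rw [Fin.val_add, Fin.val_one', Nat.add_mod_mod, Nat.mod_eq_of_lt hi]

/-- Adjacent transpositions other than `s_i` preserve the initial segment `{0, …, i}`. -/
lemma swap_add_one_le_iff {n : ℕ} [NeZero n] {i j : Fin n} (hj : (j : ℕ) + 1 < n)
    (hij : i ≠ j) (b : Fin n) : Equiv.swap j (j + 1) b ≤ i ↔ b ≤ i := by
  have h1 := Fin.val_add_one_of_lt_bound hj
  have h2 : (i : ℕ) ≠ j := fun h => hij (Fin.ext h)
  rw [Equiv.swap_apply_def]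
  split_ifs with h h'
  · subst h; simp only [Fin.le_def, h1]; omega
  · subst h'; simp only [Fin.le_def, h1]; omega
  · rfl

/-- A product of adjacent transpositions other than `s_i` preserves `{0, …, i}`. -/
lemma prod_swap_add_one_le_iff {n : ℕ} [NeZero n] {i : Fin n} (l : List (Fin n))
    (hlt : ∀ j ∈ l, (j : ℕ) + 1 < n) (hi : i ∉ l) (b : Fin n) :
    (l.map (fun j => Equiv.swap j (j + 1))).prod b ≤ i ↔ b ≤ i := by
  induction l with
  | nil => simp
  | cons j l ih =>
    simp only [List.mem_cons, not_or, forall_eq_or_imp] at hi hlt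
    rw [List.map_cons, List.prod_cons, Equiv.Perm.mul_apply,
      swap_add_one_le_iff hlt.1 hi.1, ih hlt.2 hi.2]

/-- If `w` preserves `{0, …, i}` and `f` is invariant under `s_i * w`, then `f` takes the same
value at `i` and `i + 1`. -/
lemma apply_add_one_eq_of_invariant {n : ℕ} [NeZero n] {M : Type*} [AddCommGroup M]
    {i : Fin n} (hi : (i : ℕ) + 1 < n) (w : Equiv.Perm (Fin n)) (hw : ∀ b, w b ≤ i ↔ b ≤ i)
    (f : Fin n → M) (hf : ∀ a, f (Equiv.swap i (i + 1) (w a)) = f a) :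
    f (i + 1) = f i := by
  have hsum : ∑ b ∈ Iic i, f (Equiv.swap i (i + 1) b) = ∑ b ∈ Iic i, f b := by
    rw [← Finset.sum_congr rfl fun a _ => hf a]
    exact (Finset.sum_equiv w (by simp [hw]) fun _ _ => rfl).symm
  have hmem : i ∈ Iic i := by simp
  rw [← Finset.add_sum_erase _ _ hmem, ← Finset.add_sum_erase _ f hmem,
    Equiv.swap_apply_left] at hsum
  have hrest : ∑ b ∈ (Iic i).erase i, f (Equiv.swap i (i + 1) b)
      = ∑ b ∈ (Iic i).erase i, f b := by
    refine Finset.sum_congr rfl fun b hb => ?_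
    simp only [Finset.mem_erase, Finset.mem_Iic] at hb
    rw [Equiv.swap_apply_of_ne_of_ne hb.1]
    rintro rfl
    have := hb.2
    rw [Fin.le_def, Fin.val_add_one_of_lt_bound hi] at this
    omega
  rw [hrest] at hsum
  exact add_right_cancel hsum

/-- A function is invariant under a product of distinct adjacent transpositions if and only if it
is invariant under each of them. -/
lemma invariant_prod_swap_iff {n : ℕ} [NeZero n] {M : Type*} [AddCommGroup M]
    (l : List (Fin n)) (hl : l.Nodup) (hlt : ∀ i ∈ l, (i : ℕ) + 1 < n) (f : Fin n → M) :
    (∀ a, f ((l.map (fun i => Equiv.swap i (i + 1))).prod a) = f a) ↔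
      ∀ i ∈ l, f (i + 1) = f i := by
  induction l with
  | nil => simp
  | cons i l ih =>
    rw [List.nodup_cons] at hl
    simp only [List.mem_cons, forall_eq_or_imp] at hlt ⊢
    rw [← ih hl.2 hlt.2]
    simp only [List.map_cons, List.prod_cons, Equiv.Perm.mul_apply]
    have hswap (h : f (i + 1) = f i) (b : Fin n) : f (Equiv.swap i (i + 1) b) = f b := by
      rw [Equiv.swap_apply_def]
      split_ifs with h1 h2
      · rw [h1, h]
      · rw [h2, h]
      · rfl
    constructor
    · intro h
      have hi := apply_add_one_eq_of_invariant hlt.1 _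
        (prod_swap_add_one_le_iff l hlt.2 hl.1) f h
      exact ⟨hi, fun a => by rw [← h a, hswap hi]⟩
    · rintro ⟨hi, h⟩ a
      rw [hswap hi, h]

/-- Successive differences `v (i + 1) - v i` at the positions `i ∈ s`. -/
def succDiff {n : ℕ} [NeZero n] (K : Type*) [Field K] (s : Finset (Fin n)) :
    (Fin n → K) →ₗ[K] (s → K) :=
  LinearMap.funLeft K K (fun i : s => (i : Fin n) + 1) -
    LinearMap.funLeft K K (fun i : s => (i : Fin n))

lemma succDiff_surjective {n : ℕ} [NeZero n] (K : Type*) [Field K] (s : Finset (Fin n))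
    (hs : ∀ i ∈ s, (i : ℕ) + 1 < n) : Function.Surjective (succDiff K s) := by
  intro c
  refine ⟨fun j => ∑ i ∈ ({k : s | (k : Fin n) < j} : Finset s), c i, ?_⟩
  ext i
  have hset : ({k : s | (k : Fin n) < (i : Fin n) + 1} : Finset s) =
      insert i ({k : s | (k : Fin n) < i} : Finset s) := by
    ext k
    simp only [Finset.mem_filter_univ, Finset.mem_insert, Fin.lt_def,
      Fin.val_add_one_of_lt_bound (hs i i.2), Subtype.ext_iff, Fin.ext_iff]
    omega
  simp only [succDiff, LinearMap.sub_apply, Pi.sub_apply, LinearMap.funLeft_apply]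
  rw [hset, Finset.sum_insert (by simp), add_sub_cancel_right]

lemma finrank_ker_succDiff {n : ℕ} [NeZero n] (K : Type*) [Field K] (s : Finset (Fin n))
    (hs : ∀ i ∈ s, (i : ℕ) + 1 < n) :
    finrank K (LinearMap.ker (succDiff K s)) = n - s.card := by
  have h := LinearMap.finrank_range_add_finrank_ker (succDiff K s)
  rw [LinearMap.range_eq_top.2 (succDiff_surjective K s hs), finrank_top] at h
  simp only [Module.finrank_pi, Fintype.card_coe, Fintype.card_fin] at h
  omega

/-- The number of orbits of a permutation is the dimension of its fixed space. -/
lemma ncard_sameCycle_classes {α : Type*} [Fintype α] (K : Type*) [Field K]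
    (w : Equiv.Perm α) :
    {S : Set α | ∃ a, S = {b | w.SameCycle a b}}.ncard =
      finrank K (LinearMap.ker (LinearMap.funLeft K K ⇑w - (LinearMap.id : (α → K) →ₗ[K] _))) := by
  classical
  let r := Equiv.Perm.SameCycle.setoid w
  have hclasses : {S : Set α | ∃ a, S = {b | w.SameCycle a b}} = r.classes := by
    ext S
    simp only [Setoid.classes, Set.mem_ofPred_eq]
    refine exists_congr fun a => ?_
    rw [show {b | w.SameCycle a b} = {b | r b a} from Set.ext fun b => Equiv.Perm.sameCycle_comm]
  have hrange : LinearMap.range (LinearMap.funLeft K K (Quotient.mk r)) =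
      LinearMap.ker (LinearMap.funLeft K K ⇑w - (LinearMap.id : (α → K) →ₗ[K] _)) := by
    ext f
    rw [LinearMap.mem_range, LinearMap.mem_ker, LinearMap.sub_apply, sub_eq_zero]
    constructor
    · rintro ⟨g, rfl⟩
      ext a
      exact congrArg g (Quotient.sound (Equiv.Perm.sameCycle_apply_left.2 (.refl _ _)))
    · intro hf
      have hpow (k : ℕ) (a : α) : f ((w ^ k) a) = f a := by
        induction k with
        | zero => rfl
        | succ k ih => rw [pow_succ', Equiv.Perm.mul_apply, ← ih]; exact congrFun hf _
      refine ⟨Quotient.lift f fun a b hab => ?_, rfl⟩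
      obtain ⟨k, -, -, rfl⟩ := Equiv.Perm.SameCycle.exists_pow_eq' (f := w) hab
      exact (hpow k a).symm
  rw [hclasses, ← hrange, LinearMap.finrank_range_of_inj
    (LinearMap.funLeft_injective_of_surjective K K _ Quotient.mk_surjective),
    Module.finrank_pi, ← Nat.card_eq_fintype_card, Nat.card_congr r.quotientEquivClasses,
    Nat.card_coe_set_eq]


/-- If `w ∈ S_n` is a product of pairwise distinct adjacent transpositions
`w = s_{i_1} ⋯ s_{i_k}` (`s_i = (i, i+1)`, the indices `i_1, …, i_k` pairwise
distinct), then `w` has exactly `n - k` orbits on `{1, …, n}`; equivalently,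
for any field `k0`, the fixed subspace `{v ∈ k0^n : v (w a) = v a for all a}`
of the permutation action of `w` on `k0^n` has dimension `n - k`. -/
theorem statement4 {n : ℕ} [NeZero n] (w : Equiv.Perm (Fin n)) (l : List (Fin n))
    (hl : l.Nodup) (hlt : ∀ i ∈ l, (i : ℕ) + 1 < n)
    (hw : w = (l.map (fun i => Equiv.swap i (i + 1))).prod) :
    {S : Set (Fin n) | ∃ a : Fin n, S = {b : Fin n | w.SameCycle a b}}.ncard = n - l.length ∧
    ∀ (k0 : Type) [Field k0],
      Module.finrank k0
        ↥(LinearMap.ker (LinearMap.funLeft k0 k0 ⇑w -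
            (LinearMap.id : (Fin n → k0) →ₗ[k0] (Fin n → k0)))) = n - l.length := by
  have hfin (K : Type) [Field K] : Module.finrank K
      (LinearMap.ker (LinearMap.funLeft K K ⇑w - (LinearMap.id : (Fin n → K) →ₗ[K] _))) =
        n - l.length := by
    have hker : LinearMap.ker
        (LinearMap.funLeft K K ⇑w - (LinearMap.id : (Fin n → K) →ₗ[K] _)) =
          LinearMap.ker (succDiff K l.toFinset) := by
      ext f
      have h := invariant_prod_swap_iff l hl hlt f
      rw [← hw] at h
      simpa [LinearMap.mem_ker, succDiff, funext_iff, sub_eq_zero, LinearMap.funLeft_apply]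
        using h
    rw [hker, finrank_ker_succDiff K _ (by simpa using hlt), List.toFinset_card_of_nodup hl]
  exact ⟨(ncard_sameCycle_classes ℚ w).trans (hfin ℚ), fun K _ => hfin K⟩
end

section
/- Let w ∈ S_n be such that w0·w⁻¹ is a product of pairwise distinct adjacent transpositions. Then the k-vector space of all matrices A ∈ M_n(k) satisfying: (i) A_{ab} = 0 whenever a > b; (ii) A_{w(a),w(b)} = 0 whenever a > b; and (iii) A_{aa} = A_{w(w0(a)),w(w0(a))} for all a, has dimension exactly n. -/
/-- The `k`-vector space of matrices `A` such that (i) `A` is upper triangular,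
(ii) the conjugate `P_w⁻¹ · A · P_w` is upper triangular (entrywise:
`A (w a) (w b) = 0` for `a > b`), and (iii) the diagonal of `P_w⁻¹ · A · P_w`
equals the `w0`-permuted diagonal of `A`
(entrywise: `A a a = A (w (w0 a)) (w (w0 a))` with `w0 = Fin.rev`). -/
def triSpace {n : ℕ} (k : Type*) [Field k] (w : Equiv.Perm (Fin n)) :
    Submodule k (Matrix (Fin n) (Fin n) k) where
  carrier := {A | (∀ a b : Fin n, b < a → A a b = 0) ∧
    (∀ a b : Fin n, b < a → A (w a) (w b) = 0) ∧
    ∀ a : Fin n, A a a = A (w a.rev) (w a.rev)}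
  add_mem' := by
    rintro A B ⟨hA1, hA2, hA3⟩ ⟨hB1, hB2, hB3⟩
    refine ⟨fun a b h => ?_, fun a b h => ?_, fun a => ?_⟩
    · simp [Matrix.add_apply, hA1 a b h, hB1 a b h]
    · simp [Matrix.add_apply, hA2 a b h, hB2 a b h]
    · simp [Matrix.add_apply, hA3 a, hB3 a]
  zero_mem' := ⟨fun _ _ _ => rfl, fun _ _ _ => rfl, fun _ => rfl⟩
  smul_mem' := by
    rintro t A ⟨h1, h2, h3⟩
    refine ⟨fun a b h => ?_, fun a b h => ?_, fun a => ?_⟩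
    · simp [Matrix.smul_apply, h1 a b h]
    · simp [Matrix.smul_apply, h2 a b h]
    · simp [Matrix.smul_apply, h3 a]

/-- A product of adjacent transpositions other than `(i, i + 1)` preserves the initial segment
ending at `i`. -/
theorem prod_map_swap_apply_le_iff {n : ℕ} [NeZero n] (l : List (Fin n))
    (hlt : ∀ j ∈ l, (j : ℕ) + 1 < n) {i : Fin n} (hi : i ∉ l) (x : Fin n) :
    (l.map (fun j => Equiv.swap j (j + 1))).prod x ≤ i ↔ x ≤ i := by
  induction l with
  | nil => simp
  | cons j l ih =>
    simp only [List.mem_cons, not_or, forall_eq_or_imp] at hi hlt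
    have hj : ((j + 1 : Fin n) : ℕ) = j + 1 := Fin.val_add_one_of_lt' hlt.1
    rw [List.map_cons, List.prod_cons, Equiv.Perm.mul_apply, ← ih hlt.2 hi.2,
      Equiv.swap_apply_def]
    have hne : (i : ℕ) ≠ j := fun h => hi.1 (Fin.ext h)
    split_ifs with h₁ h₂
    · rw [h₁, Fin.le_def, Fin.le_def]; omega
    · rw [h₂, Fin.le_def, Fin.le_def]; omega
    · rfl

/-- The set of inversions of a permutation. -/
def inversionFinset {n : ℕ} (v : Equiv.Perm (Fin n)) : Finset (Fin n × Fin n) :=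
  Finset.univ.filter fun p => p.1 < p.2 ∧ v p.2 < v p.1

theorem mem_inversionFinset {n : ℕ} {v : Equiv.Perm (Fin n)} {p : Fin n × Fin n} :
    p ∈ inversionFinset v ↔ p.1 < p.2 ∧ v p.2 < v p.1 := by
  simp [inversionFinset]

theorem inversionFinset_swap_mul {n : ℕ} (v : Equiv.Perm (Fin n)) {i j : Fin n}
    (hij : (j : ℕ) = i + 1) (h : v.symm i < v.symm j) :
    inversionFinset (Equiv.swap i j * v) =
      insert (v.symm i, v.symm j) (inversionFinset v) := by
  ext ⟨p, q⟩
  obtain ⟨x, rfl⟩ := v.symm.surjective p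
  obtain ⟨y, rfl⟩ := v.symm.surjective q
  simp only [mem_inversionFinset, Finset.mem_insert, Prod.mk.injEq, Equiv.Perm.mul_apply,
    Equiv.apply_symm_apply, EmbeddingLike.apply_eq_iff_eq, Equiv.swap_apply_def]
  grind

theorem card_inversionFinset_prod_map_swap {n : ℕ} [NeZero n] (l : List (Fin n))
    (hl : l.Nodup) (hlt : ∀ i ∈ l, (i : ℕ) + 1 < n) :
    (inversionFinset (l.map (fun i => Equiv.swap i (i + 1))).prod).card = l.length := by
  induction l with
  | nil =>
    simp only [List.map_nil, List.prod_nil, List.length_nil, Finset.card_eq_zero]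
    ext p
    simp only [mem_inversionFinset, Equiv.Perm.coe_one, id, Finset.notMem_empty, iff_false]
    exact fun h => lt_asymm h.1 h.2
  | cons i l ih =>
    simp only [List.nodup_cons, List.mem_cons, forall_eq_or_imp] at hl hlt
    have hi : ((i + 1 : Fin n) : ℕ) = i + 1 := Fin.val_add_one_of_lt' hlt.1
    have key := prod_map_swap_apply_le_iff l hlt.2 hl.1
    rw [List.map_cons, List.prod_cons]
    set v := (l.map (fun i => Equiv.swap i (i + 1))).prod
    have h₁ : v.symm i ≤ i := (key _).1 (by simp)
    have h₂ : i < v.symm (i + 1) := by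
      rw [← not_le, ← key, Equiv.apply_symm_apply, Fin.le_def]; omega
    rw [inversionFinset_swap_mul v hi (h₁.trans_lt h₂), Finset.card_insert_of_notMem,
      ih hl.2 hlt.2, List.length_cons]
    simp only [mem_inversionFinset, Equiv.apply_symm_apply, Fin.lt_def]
    omega

/-- A function is invariant under a product of distinct adjacent transpositions if and only if
it is invariant under each of them. -/
theorem comp_prod_map_swap_eq_self_iff {n : ℕ} [NeZero n] {M : Type*} [AddCommGroup M]
    (l : List (Fin n)) (hl : l.Nodup) (hlt : ∀ i ∈ l, (i : ℕ) + 1 < n) (d : Fin n → M) :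
    (∀ x, d ((l.map (fun i => Equiv.swap i (i + 1))).prod x) = d x) ↔
      ∀ i ∈ l, d (i + 1) = d i := by
  induction l with
  | nil => simp
  | cons i l ih =>
    simp only [List.nodup_cons, List.mem_cons, forall_eq_or_imp] at hl hlt ⊢
    have hi : ((i + 1 : Fin n) : ℕ) = i + 1 := Fin.val_add_one_of_lt' hlt.1
    have key := prod_map_swap_apply_le_iff l hlt.2 hl.1
    rw [← ih hl.2 hlt.2]
    simp only [List.map_cons, List.prod_cons, Equiv.Perm.mul_apply]
    set v := (l.map (fun i => Equiv.swap i (i + 1))).prod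
    have hs : d (i + 1) = d i → ∀ x, d (Equiv.swap i (i + 1) x) = d x := by
      intro h x
      rw [Equiv.swap_apply_def]
      split_ifs with h₁ h₂
      · rw [h₁, h]
      · rw [h₂, h]
      · rfl
    constructor
    · intro h
      have hstep : d (i + 1) = d i := by
        have h₁ : ∑ x ∈ Finset.Iic i, d (Equiv.swap i (i + 1) x) = ∑ x ∈ Finset.Iic i, d x := by
          rw [← Finset.sum_congr rfl fun x _ => h x]
          exact (Finset.sum_equiv v (by simp [key]) (by simp)).symm
        rw [← Finset.Iio_insert, Finset.sum_insert (by simp), Finset.sum_insert (by simp),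
          Equiv.swap_apply_left] at h₁
        have h₂ : ∑ x ∈ Finset.Iio i, d (Equiv.swap i (i + 1) x) = ∑ x ∈ Finset.Iio i, d x := by
          refine Finset.sum_congr rfl fun x hx => ?_
          rw [Finset.mem_Iio, Fin.lt_def] at hx
          rw [Equiv.swap_apply_of_ne_of_ne (Fin.ne_of_val_ne (by omega))
            (Fin.ne_of_val_ne (by omega))]
        rw [h₂] at h₁
        exact add_right_cancel h₁
      exact ⟨hstep, fun x => (hs hstep (v x)).symm.trans (h x)⟩
    · rintro ⟨h₁, h₂⟩ x
      rw [hs h₁, h₂]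

/-- The map taking a function on `Fin n` to its differences `d (i + 1) - d i`, `i ∈ s`. -/
def differenceMap {n : ℕ} [NeZero n] (k : Type*) [Field k] (s : Finset (Fin n)) :
    (Fin n → k) →ₗ[k] (s → k) where
  toFun d i := d (i + 1) - d i
  map_add' d e := by ext i; simp only [Pi.add_apply]; ring
  map_smul' c d := by ext i; simp only [Pi.smul_apply, smul_eq_mul, RingHom.id_apply]; ring

theorem mem_ker_differenceMap {n : ℕ} [NeZero n] {k : Type*} [Field k] {s : Finset (Fin n)}
    {d : Fin n → k} : d ∈ (differenceMap k s).ker ↔ ∀ i ∈ s, d (i + 1) = d i := by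
  simp [differenceMap, funext_iff, sub_eq_zero]

theorem differenceMap_surjective {n : ℕ} [NeZero n] (k : Type*) [Field k]
    (s : Finset (Fin n)) (hs : ∀ i ∈ s, (i : ℕ) + 1 < n) :
    Function.Surjective (differenceMap k s) := by
  intro c
  refine ⟨fun j => ∑ i : s with i.1 < j, c i, funext fun i => ?_⟩
  have hi : ((i.1 + 1 : Fin n) : ℕ) = i.1 + 1 := Fin.val_add_one_of_lt' (hs i i.2)
  have : (Finset.univ.filter fun j : s => j.1 < i.1 + 1) =
      insert i (Finset.univ.filter fun j : s => j.1 < i.1) := by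
    ext j
    simp only [Finset.mem_filter, Finset.mem_univ, true_and, Finset.mem_insert, Subtype.ext_iff,
      Fin.ext_iff, Fin.lt_def, hi]
    omega
  change ∑ j : s with j.1 < i.1 + 1, c j - ∑ j : s with j.1 < i.1, c j = c i
  rw [this, Finset.sum_insert (by simp), add_sub_cancel_right]

theorem finrank_ker_differenceMap_add_card {n : ℕ} [NeZero n] (k : Type*) [Field k]
    (s : Finset (Fin n)) (hs : ∀ i ∈ s, (i : ℕ) + 1 < n) :
    Module.finrank k (differenceMap k s).ker + s.card = n := by
  have h := (differenceMap k s).finrank_range_add_finrank_ker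
  rw [LinearMap.range_eq_top.2 (differenceMap_surjective k s hs), finrank_top] at h
  simp only [Module.finrank_fintype_fun_eq_card, Fintype.card_coe, Fintype.card_fin] at h
  omega

theorem mem_triSpace_iff {n : ℕ} {k : Type*} [Field k] {w v : Equiv.Perm (Fin n)}
    (hv : Fin.revPerm * w⁻¹ = v) {A : Matrix (Fin n) (Fin n) k} :
    A ∈ triSpace k w ↔ (∀ p q, p ≠ q → (p, q) ∉ inversionFinset v → A p q = 0) ∧
      ∀ a, A (v a) (v a) = A a a := by
  have hva : ∀ a, w (v a).rev = a := fun a => by simp [← hv]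
  have hvw : ∀ a, v (w a) = a.rev := fun a => by simp [← hv]
  constructor
  · rintro ⟨h₁, h₂, h₃⟩
    refine ⟨fun p q hpq hinv => ?_, fun a => ?_⟩
    · rcases lt_or_gt_of_ne hpq with h | h
      · rw [← hva p, ← hva q]
        refine h₂ _ _ (Fin.rev_lt_rev.2 (lt_of_le_of_ne ?_ (v.injective.ne hpq)))
        by_contra! hlt
        exact hinv (mem_inversionFinset.2 ⟨h, hlt⟩)
      · exact h₁ p q h
    · rw [h₃ (v a), hva]
  · rintro ⟨h₁, h₂⟩
    refine ⟨fun a b h => h₁ a b h.ne' fun hm => ?_,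
      fun a b h => h₁ _ _ (w.injective.ne h.ne') fun hm => ?_, fun a => ?_⟩
    · exact lt_asymm h (mem_inversionFinset.1 hm).1
    · have := (mem_inversionFinset.1 hm).2
      simp only [hvw, Fin.rev_lt_rev] at this
      exact lt_asymm h this
    · rw [← h₂ (w a.rev), hvw, Fin.rev_rev]

/-- A matrix in `triSpace k w` amounts to a diagonal invariant under `v = w0 * w⁻¹` together with
arbitrary entries at the inversions of `v`. -/
def triSpaceEquiv {n : ℕ} {k : Type*} [Field k] {w v : Equiv.Perm (Fin n)}
    (hv : Fin.revPerm * w⁻¹ = v) (D : Submodule k (Fin n → k))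
    (hD : ∀ d, d ∈ D ↔ ∀ x, d (v x) = d x) :
    triSpace k w ≃ₗ[k] D × (inversionFinset v → k) where
  toFun A := (⟨fun a => A.1 a a, (hD _).2 ((mem_triSpace_iff hv).1 A.2).2⟩,
    fun p => A.1 p.1.1 p.1.2)
  map_add' _ _ := rfl
  map_smul' _ _ := rfl
  invFun x := ⟨Matrix.of fun p q => if p = q then x.1.1 p else
      if h : (p, q) ∈ inversionFinset v then x.2 ⟨(p, q), h⟩ else 0,
    (mem_triSpace_iff hv).2 ⟨fun p q hpq h => by simp [hpq, h],
      fun a => by simpa using (hD _).1 x.1.2 a⟩⟩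
  left_inv A := by
    ext p q
    have := ((mem_triSpace_iff hv).1 A.2).1 p q
    by_cases hpq : p = q
    · simp [hpq]
    · by_cases h : (p, q) ∈ inversionFinset v
      · simp [hpq, h]
      · simp [hpq, h, this hpq h]
  right_inv x := by
    refine Prod.ext (Subtype.ext (funext fun a => by simp)) (funext fun p => ?_)
    have hp := (mem_inversionFinset.1 p.2).1.ne
    simp [hp]

/-- Let `w ∈ S_n` be such that `w0 · w⁻¹` is a product of pairwise distinct
adjacent transpositions.  Then the space of matrices `A` satisfying
(i) `A a b = 0` for `a > b`, (ii) `A (w a) (w b) = 0` for `a > b`, and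
(iii) `A a a = A (w (w0 a)) (w (w0 a))` for all `a`, has dimension exactly `n`. -/
theorem statement5 {n : ℕ} [NeZero n] {k : Type*} [Field k] (w : Equiv.Perm (Fin n))
    (l : List (Fin n)) (hl : l.Nodup) (hlt : ∀ i ∈ l, (i : ℕ) + 1 < n)
    (hw : (Fin.revPerm : Equiv.Perm (Fin n)) * w⁻¹ =
      (l.map (fun i => Equiv.swap i (i + 1))).prod) :
    Module.finrank k (triSpace k w) = n := by
  have e := triSpaceEquiv (k := k) hw (differenceMap k l.toFinset).ker fun d => by
    rw [mem_ker_differenceMap, comp_prod_map_swap_eq_self_iff l hl hlt]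
    simp only [List.mem_toFinset]
  have h := finrank_ker_differenceMap_add_card k l.toFinset (by simpa using hlt)
  rw [e.finrank_eq, Module.finrank_prod, Module.finrank_fintype_fun_eq_card, Fintype.card_coe,
    card_inversionFinset_prod_map_swap l hl hlt, ← List.toFinset_card_of_nodup hl, h]
end

section
/- Let w1, w2, w ∈ S_n and let b ∈ B(k). If P_{w1}⁻¹·b·P_{w2} ∈ B(k)·P_w·B(k), then w1⁻¹·w2 ≤ w in the Bruhat order on S_n. -/
/-- The product of adjacent transpositions `s_{i_1} ⋯ s_{i_ℓ}` indexed by the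
list `l` (where `s_i = (i, i+1)`). -/
def adjWord {n : ℕ} [NeZero n] (l : List (Fin n)) : Equiv.Perm (Fin n) :=
  (l.map (fun i => Equiv.swap i (i + 1))).prod

/-- The list `l` consists of valid indices of adjacent transpositions,
i.e. `i + 1 < n` for each `i ∈ l` (0-indexed). -/
def IsAdjIndices {n : ℕ} (l : List (Fin n)) : Prop := ∀ i ∈ l, (i : ℕ) + 1 < n

/-- The Bruhat order on `S_n`, via the subword property: `u ≤ w` iff some
(equivalently, every) reduced expression of `w` as a product of adjacent
transpositions admits a subsequence whose product is `u`. -/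
def BruhatLE {n : ℕ} [NeZero n] (u w : Equiv.Perm (Fin n)) : Prop :=
  ∃ l : List (Fin n), IsAdjIndices l ∧ adjWord l = w ∧
    (∀ l' : List (Fin n), IsAdjIndices l' → adjWord l' = w → l.length ≤ l'.length) ∧
    ∃ l'' : List (Fin n), l''.Sublist l ∧ adjWord l'' = u

namespace Bruhat

open Matrix

variable {n : ℕ} {k : Type*} [Field k]

lemma permMat_mul_apply (x : Equiv.Perm (Fin n)) (M : Matrix (Fin n) (Fin n) k) (a c : Fin n) :
    (permMat k x * M) a c = M (x⁻¹ a) c := by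
  have h : ∀ j, (a = x j) ↔ (j = x⁻¹ a) := fun j => by
    rw [Equiv.Perm.eq_inv_iff_eq, eq_comm]
  simp [permMat, Matrix.mul_apply, h]

lemma mul_permMat_apply (x : Equiv.Perm (Fin n)) (M : Matrix (Fin n) (Fin n) k) (a c : Fin n) :
    (M * permMat k x) a c = M a (x c) := by
  simp [permMat, Matrix.mul_apply]

lemma permMat_mul (x y : Equiv.Perm (Fin n)) :
    permMat k (x * y) = permMat k x * permMat k y := by
  ext a c
  rw [mul_permMat_apply]
  rfl

lemma permMat_one : permMat k (1 : Equiv.Perm (Fin n)) = 1 := by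
  ext a c
  simp only [permMat, Matrix.of_apply, Matrix.one_apply, Equiv.Perm.one_apply]
  congr

/-- The permutation matrices, as a homomorphism to the general linear group. -/
def permUnit (k : Type*) [Field k] (n : ℕ) :
    Equiv.Perm (Fin n) →* (Matrix (Fin n) (Fin n) k)ˣ :=
  MonoidHom.toHomUnits
    { toFun := permMat k
      map_one' := permMat_one
      map_mul' := permMat_mul }

@[simp]
lemma coe_permUnit (x : Equiv.Perm (Fin n)) :
    (permUnit k n x : Matrix (Fin n) (Fin n) k) = permMat k x := rfl

/-- The subgroup of invertible upper triangular matrices. -/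
def borel (k : Type*) [Field k] (n : ℕ) : Subgroup (Matrix (Fin n) (Fin n) k)ˣ where
  carrier := {g | (g : Matrix (Fin n) (Fin n) k).BlockTriangular id}
  one_mem' := blockTriangular_one
  mul_mem' hg hh := BlockTriangular.mul hg hh
  inv_mem' {g} hg := by
    have : Invertible (g : Matrix (Fin n) (Fin n) k) := g.invertible
    have h := blockTriangular_inv_of_blockTriangular hg
    rwa [← Matrix.coe_units_inv] at h

lemma mem_borel {g : (Matrix (Fin n) (Fin n) k)ˣ} :
    g ∈ borel k n ↔ ∀ a c : Fin n, c < a → (g : Matrix (Fin n) (Fin n) k) a c = 0 := Iff.rfl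

lemma diag_ne_zero_of_mem_borel {g : (Matrix (Fin n) (Fin n) k)ˣ} (hg : g ∈ borel k n)
    (a : Fin n) : (g : Matrix (Fin n) (Fin n) k) a a ≠ 0 := by
  have h := (Matrix.isUnit_iff_isUnit_det _).1 g.isUnit
  rw [det_of_isUpperTriangular hg] at h
  exact Finset.prod_ne_zero_iff.1 h.ne_zero a (Finset.mem_univ a)

lemma le_of_permUnit_mul_eq {x y : Equiv.Perm (Fin n)} {c d : (Matrix (Fin n) (Fin n) k)ˣ}
    (hc : c ∈ borel k n) (hd : d ∈ borel k n)
    (h : permUnit k n x * d = c * permUnit k n y) (a : Fin n) : x a ≤ y a := by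
  have h' := congrArg (fun g : (Matrix (Fin n) (Fin n) k)ˣ =>
    (g : Matrix (Fin n) (Fin n) k) (x a) a) h
  simp only [Units.val_mul, coe_permUnit, permMat_mul_apply, mul_permMat_apply,
    Equiv.Perm.inv_def, Equiv.symm_apply_apply] at h'
  by_contra! hlt
  exact diag_ne_zero_of_mem_borel hd a (h'.trans (hc hlt))

/-- Distinct permutations give disjoint Bruhat double cosets. -/
lemma eq_of_permUnit_mul_eq {x y : Equiv.Perm (Fin n)} {c d : (Matrix (Fin n) (Fin n) k)ˣ}
    (hc : c ∈ borel k n) (hd : d ∈ borel k n)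
    (h : permUnit k n x * d = c * permUnit k n y) : x = y := by
  refine Equiv.ext fun a => le_antisymm (le_of_permUnit_mul_eq hc hd h a) ?_
  refine le_of_permUnit_mul_eq (inv_mem hc) (inv_mem hd) ?_ a
  rw [mul_inv_eq_iff_eq_mul, mul_assoc, h, inv_mul_cancel_left]

/-- The elementary transvections, as units. -/
def transvectionUnit {i j : Fin n} (hij : i ≠ j) (t : k) : (Matrix (Fin n) (Fin n) k)ˣ where
  val := transvection i j t
  inv := transvection i j (-t)
  val_inv := by rw [transvection_mul_transvection_same _ _ hij, add_neg_cancel, transvection_zero]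
  inv_val := by rw [transvection_mul_transvection_same _ _ hij, neg_add_cancel, transvection_zero]

lemma transvectionUnit_inv {i j : Fin n} (hij : i ≠ j) (t : k) :
    (transvectionUnit hij t)⁻¹ = transvectionUnit hij (-t) := by
  ext1; rfl

lemma transvection_mul_apply {i j : Fin n} (t : k) (M : Matrix (Fin n) (Fin n) k)
    (a c : Fin n) :
    (transvection i j t * M) a c = M a c + if a = i then t * M j c else 0 := by
  split_ifs with h
  · subst h; exact transvection_mul_apply_same ..
  · rw [transvection_mul_apply_of_ne _ _ _ _ h, add_zero]

lemma transvectionUnit_mem_borel {i j : Fin n} (hij : i ≠ j) {t : k} (h : i < j ∨ t = 0) :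
    transvectionUnit hij t ∈ borel k n := by
  rcases h with h | rfl
  · exact blockTriangular_transvection (b := id) h.le t
  · convert one_mem (borel k n)
    ext1
    exact transvection_zero ..

lemma permUnit_mul_transvectionUnit (x : Equiv.Perm (Fin n)) {i j : Fin n} (hij : i ≠ j)
    (t : k) :
    permUnit k n x * transvectionUnit hij t =
      transvectionUnit (x.injective.ne hij) t * permUnit k n x := by
  ext a c
  simp only [Units.val_mul, coe_permUnit, permMat_mul_apply, mul_permMat_apply]
  simp [transvectionUnit, transvection, Matrix.single_apply, Matrix.one_apply,
    Equiv.symm_apply_eq, Equiv.eq_symm_apply]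

/-- The product rule `w B s ⊆ B w B ∪ B w s B` for an adjacent transposition `s`. -/
lemma permUnit_mul_mul_swap (x : Equiv.Perm (Fin n)) {i j : Fin n} (hij : (j : ℕ) = i + 1)
    {b : (Matrix (Fin n) (Fin n) k)ˣ} (hb : b ∈ borel k n) :
    ∃ y, (y = x ∨ y = x * Equiv.swap i j) ∧ ∃ c ∈ borel k n, ∃ d ∈ borel k n,
      permUnit k n x * b * permUnit k n (Equiv.swap i j) = c * permUnit k n y * d := by
  have hne : i ≠ j := by rintro rfl; omega
  have hr := diag_ne_zero_of_mem_borel hb j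
  have hb' := mem_borel.1 hb
  set s := Equiv.swap i j with hs
  set q := (b : Matrix (Fin n) (Fin n) k) i j with hq
  set r := (b : Matrix (Fin n) (Fin n) k) j j with hr'
  by_cases hcase : x i < x j ∨ q / r = 0
  · refine ⟨x * s, Or.inr rfl, _,
      transvectionUnit_mem_borel (x.injective.ne hne) (t := q / r) hcase,
      permUnit k n s * (transvectionUnit hne (-(q / r)) * b) * permUnit k n s, ?_, ?_⟩
    · rw [mem_borel]
      intro a c hca
      have hqr : q + -(q / r) * r = 0 := by field_simp; ring
      simp only [Units.val_mul, coe_permUnit, permMat_mul_apply,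
        mul_permMat_apply, transvectionUnit, transvection_mul_apply, hs, Equiv.swap_inv,
        Equiv.swap_apply_def]
      grind
    · rw [← transvectionUnit_inv, map_mul]
      have hss : permUnit k n s * permUnit k n s = 1 := by
        rw [← map_mul, Equiv.swap_mul_self, map_one]
      have h1 := permUnit_mul_transvectionUnit (k := k) x hne (q / r)
      calc _ = permUnit k n x * transvectionUnit hne (q / r) *
            ((transvectionUnit hne (q / r))⁻¹ * b * permUnit k n s) := by group
        _ = transvectionUnit (x.injective.ne hne) (q / r) * permUnit k n x *
            (permUnit k n s * permUnit k n s) *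
            ((transvectionUnit hne (q / r))⁻¹ * b * permUnit k n s) := by
          rw [h1, hss, mul_one]
        _ = _ := by simp only [mul_assoc]
  · push Not at hcase
    have hq0 : q ≠ 0 := fun h => hcase.2 (by rw [h, zero_div])
    have hlt : x j < x i := lt_of_le_of_ne hcase.1 (x.injective.ne hne.symm)
    refine ⟨x, Or.inl rfl, _,
      transvectionUnit_mem_borel (x.injective.ne hne.symm) (t := r / q) (Or.inl hlt),
      transvectionUnit hne.symm (-(r / q)) * b * permUnit k n s, ?_, ?_⟩
    · rw [mem_borel]
      intro a c hca
      have hqr : r + -(r / q) * q = 0 := by field_simp; ring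
      simp only [Units.val_mul, coe_permUnit, mul_permMat_apply, transvectionUnit,
        transvection_mul_apply, hs, Equiv.swap_apply_def]
      grind
    · rw [← transvectionUnit_inv, ← permUnit_mul_transvectionUnit x hne.symm]
      group

/-- A product `w B s₁ ⋯ s_ℓ` lies in the union of the double cosets `B w u B`, where `u` runs
over the subwords of `s₁ ⋯ s_ℓ`. -/
lemma exists_sublist_permUnit_mul_mul [NeZero n] (l : List (Fin n)) (hl : IsAdjIndices l)
    (x : Equiv.Perm (Fin n)) {b : (Matrix (Fin n) (Fin n) k)ˣ} (hb : b ∈ borel k n) :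
    ∃ l' : List (Fin n), l'.Sublist l ∧ ∃ c ∈ borel k n, ∃ d ∈ borel k n,
      permUnit k n x * b * permUnit k n (adjWord l) =
        c * permUnit k n (x * adjWord l') * d := by
  induction l generalizing x b with
  | nil => exact ⟨[], List.Sublist.refl _, 1, one_mem _, b, hb, by simp [adjWord]⟩
  | cons i l ih =>
    have hi : ((i + 1 : Fin n) : ℕ) = i + 1 :=
      Fin.val_add_one_of_lt' (hl i List.mem_cons_self)
    have hcons (m : List (Fin n)) : adjWord (i :: m) = Equiv.swap i (i + 1) * adjWord m := by
      simp [adjWord]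
    obtain ⟨y, hy, c, hc, d, hd, h⟩ := permUnit_mul_mul_swap x hi hb
    obtain ⟨l', hl', c', hc', d', hd', h'⟩ :=
      ih (fun j hj => hl j (List.mem_cons_of_mem _ hj)) y hd
    have key : permUnit k n x * b * permUnit k n (adjWord (i :: l)) =
        c * c' * permUnit k n (y * adjWord l') * d' := by
      rw [hcons, map_mul, ← mul_assoc, h, mul_assoc c, mul_assoc c, h']
      simp only [mul_assoc]
    rcases hy with rfl | rfl
    · exact ⟨l', hl'.cons i, c * c', mul_mem hc hc', d', hd', key⟩
    · refine ⟨i :: l', hl'.cons_cons i, c * c', mul_mem hc hc', d', hd', ?_⟩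
      rw [key, hcons, mul_assoc x]

/-- Every permutation is a product of adjacent transpositions. -/
lemma exists_adjWord_eq [NeZero n] (w : Equiv.Perm (Fin n)) :
    ∃ l : List (Fin n), IsAdjIndices l ∧ adjWord l = w := by
  obtain ⟨m, rfl⟩ := Nat.exists_eq_succ_of_ne_zero (NeZero.ne n)
  have hw : w ∈ Submonoid.closure
      (Set.range fun i : Fin m => Equiv.swap i.castSucc i.succ) := by
    rw [Equiv.Perm.mclosure_swap_castSucc_succ]
    trivial
  induction hw using Submonoid.closure_induction with
  | mem x hx =>
    obtain ⟨i, rfl⟩ := hx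
    refine ⟨[i.castSucc], by simp [IsAdjIndices], ?_⟩
    have : i.castSucc + 1 = i.succ := Fin.coeSucc_eq_succ
    simp [adjWord]
  | one => exact ⟨[], by simp [IsAdjIndices], rfl⟩
  | mul x y _ _ hx hy =>
    obtain ⟨l, hl, rfl⟩ := hx
    obtain ⟨l', hl', rfl⟩ := hy
    refine ⟨l ++ l', fun i hi => ?_, by simp [adjWord]⟩
    exact (List.mem_append.1 hi).elim (hl i) (hl' i)

end Bruhat

/-- Let `w1, w2, w ∈ S_n` and `b ∈ B(k)`.  If `P_{w1}⁻¹ · b · P_{w2}` lies in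
the Bruhat double coset `B(k) · P_w · B(k)`, then `w1⁻¹ · w2 ≤ w` in the
Bruhat order. -/
theorem statement9 {n : ℕ} [NeZero n] {k : Type*} [Field k]
    (w1 w2 w : Equiv.Perm (Fin n)) (b : Matrix (Fin n) (Fin n) k)
    (hb : IsUnit b) (hbu : ∀ a c : Fin n, c < a → b a c = 0)
    (h : ∃ b1 b2 : Matrix (Fin n) (Fin n) k, IsUnit b1 ∧ IsUnit b2 ∧
      (∀ a c : Fin n, c < a → b1 a c = 0) ∧ (∀ a c : Fin n, c < a → b2 a c = 0) ∧
      permMat k w1⁻¹ * b * permMat k w2 = b1 * permMat k w * b2) :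
    BruhatLE (w1⁻¹ * w2) w := by
  obtain ⟨b1, b2, ⟨b1, rfl⟩, ⟨b2, rfl⟩, h1, h2, h⟩ := h
  obtain ⟨b, rfl⟩ := hb
  have h' : Bruhat.permUnit k n w1⁻¹ * b * Bruhat.permUnit k n w2 =
      b1 * Bruhat.permUnit k n w * b2 := Units.ext h
  obtain ⟨l, ⟨hl, rfl⟩, hmin⟩ := exists_minimalFor_of_wellFoundedLT
    (fun l : List (Fin n) => IsAdjIndices l ∧ adjWord l = w) List.length
    (Bruhat.exists_adjWord_eq w)
  obtain ⟨l', hl', c, hc, d, hd, hx⟩ :=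
    Bruhat.exists_sublist_permUnit_mul_mul l hl w1 (b := b1) (Bruhat.mem_borel.2 h1)
  refine ⟨l, hl, rfl, fun m hm hm' => ?_, l', hl', ?_⟩
  · exact (le_total l.length m.length).elim id (hmin ⟨hm, hm'⟩)
  · have h3 : w1 * adjWord l' = w2 := by
      refine Bruhat.eq_of_permUnit_mul_eq (c := c⁻¹ * b) (d := d * b2)
        (mul_mem (inv_mem hc) hbu) (mul_mem hd h2) ?_
      calc _ = c⁻¹ * (c * Bruhat.permUnit k n (w1 * adjWord l') * d) * b2 := by group
        _ = c⁻¹ * Bruhat.permUnit k n w1 * (b1 * Bruhat.permUnit k n (adjWord l) * b2) := by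
          rw [← hx]; simp only [mul_assoc]
        _ = _ := by rw [← h', map_inv]; group
    rw [← h3, inv_mul_cancel_left]
end

section
/- Let G be a group, N ⊆ G a subgroup of index 2, and A a commutative group. Let χ : G → A and ψ : N → A be group homomorphisms, and suppose there exists c ∈ G∖N with c² = 1 such that χ(x) = ψ(x)·ψ(c·x·c) for all x ∈ N. Then χ(c₁) = χ(c₂) for any two elements c₁, c₂ ∈ G∖N satisfying c₁² = c₂² = 1. -/
/-- If `χ` restricted to an index-two subgroup `N` is `ψ · ψ^c` for an involution `c ∉ N`, then
`χ (d * c) = 1` for every involution `d ∉ N`. -/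
theorem map_mul_eq_one_of_involutions {G A : Type*} [Group G] [CommGroup A] {N : Subgroup G}
    (hN : N.index = 2) (χ : G →* A) (ψ : N →* A) {c d : G} (hc : c ∉ N) (hc2 : c ^ 2 = 1)
    (hfact : ∀ x y : N, (y : G) = c * (x : G) * c → χ (x : G) = ψ x * ψ y)
    (hd : d ∉ N) (hd2 : d ^ 2 = 1) : χ (d * c) = 1 := by
  rw [pow_two] at hc2 hd2
  have hdc : d * c ∈ N := (Subgroup.mul_mem_iff_of_index_two hN).2 (by simp [hc, hd])
  have hcd : c * d ∈ N := (Subgroup.mul_mem_iff_of_index_two hN).2 (by simp [hc, hd])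
  have hinv : (⟨d * c, hdc⟩ : N) * ⟨c * d, hcd⟩ = 1 :=
    Subtype.ext (by simp [mul_assoc, ← mul_assoc c c d, hc2, hd2])
  rw [hfact ⟨d * c, hdc⟩ ⟨c * d, hcd⟩ (by simp [mul_assoc, hc2]), ← map_mul, hinv, map_one]

/-- Let `G` be a group, `N ⊆ G` a subgroup of index 2, and `A` a commutative
group.  Let `χ : G → A` and `ψ : N → A` be homomorphisms, and suppose there
exists `c ∈ G ∖ N` with `c² = 1` such that `χ(x) = ψ(x) · ψ(c·x·c)` for all
`x ∈ N` (the element `c·x·c` lies in `N` since `N` has index 2; this is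
encoded by quantifying over `y ∈ N` with `(y : G) = c·x·c`).  Then
`χ(c₁) = χ(c₂)` for any two elements `c₁, c₂ ∈ G ∖ N` with `c₁² = c₂² = 1`. -/
theorem statement10 {G A : Type*} [Group G] [CommGroup A] (N : Subgroup G)
    (hN : N.index = 2) (χ : G →* A) (ψ : N →* A) (c : G) (hc : c ∉ N)
    (hc2 : c ^ 2 = 1)
    (hfact : ∀ x y : N, (y : G) = c * (x : G) * c → χ (x : G) = ψ x * ψ y)
    (c₁ c₂ : G) (hc₁ : c₁ ∉ N) (hc₂ : c₂ ∉ N) (h₁ : c₁ ^ 2 = 1) (h₂ : c₂ ^ 2 = 1) :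
    χ c₁ = χ c₂ := by
  have h := (map_mul_eq_one_of_involutions hN χ ψ hc hc2 hfact hc₁ h₁).trans
    (map_mul_eq_one_of_involutions hN χ ψ hc hc2 hfact hc₂ h₂).symm
  rw [map_mul, map_mul] at h
  exact mul_right_cancel h
end
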